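/- arXiv:1211.7053 — 2 statements merged into one kernel-verified Lean document; each statement's English description precedes it below -/
import Mathlib

section
/- Rajan's identity: Let v₀, …, v_d be affinely independent points in ℝ^d, let Δ be their convex hull, and let g : ℝ^d → ℝ be the unique affine map with g(v_i) = ‖v_i‖² for all i. Then ∫_Δ (g(x) − ‖x‖²) dx = vol(Δ) · (Σ_{0 ≤ i < j ≤ d} ‖v_i − v_j‖²) / ((d+1)(d+2)), where vol(Δ) is the d-dimensional Lebesgue measure of Δ and the integral is with respect to d-dimensional Lebesgue measure. Equivalently, F_R(Δ) = (d+1)(d+2)·F_E(Δ), where F_R(Δ) = vol(Δ)·Σ_{i<j}‖v_i − v_j‖² and F_E(Δ) = ∫_Δ (g(x) − ‖x‖²) dx. -/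
open Metric MeasureTheory Filter

noncomputable section

section Moments

variable {ι E : Type*} [NormedAddCommGroup E] [NormedSpace ℝ E]

theorem AffineBasis.coord_add_smul_sub (b : AffineBasis ι ℝ E) (k i j : ι) (x : E) (c : ℝ) :
    b.coord k (x + c • (b i - b j)) =
      b.coord k x + c * (b.coord k (b i) - b.coord k (b j)) := by
  have h : x + c • (b i - b j) = c • (b i -ᵥ b j) +ᵥ x := by
    simp [add_comm]
  have h' := (b.coord k).linearMap_vsub (b i) (b j)
  rw [h, AffineMap.map_vadd, map_smul, h']
  simp [add_comm]

/-- The affine map sending `b j` to the midpoint of `b i` and `b j` and fixing the other vertices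
maps the simplex onto one of the two halves cut out by the bisecting hyperplane. -/
theorem AffineBasis.image_convexHull_bisection (b : AffineBasis ι ℝ E) {i j : ι} (hij : i ≠ j) :
    (fun x ↦ x + (b.coord j x / 2) • (b i - b j)) '' convexHull ℝ (Set.range b) =
      convexHull ℝ (Set.range b) ∩ {x | b.coord j x ≤ b.coord i x} := by
  classical
  rw [b.convexHull_eq_nonneg_coord]
  ext y
  constructor
  · rintro ⟨x, hx, rfl⟩
    have hx' : ∀ k, 0 ≤ b.coord k x := hx
    refine ⟨fun k ↦ ?_, ?_⟩
    · have := hx' k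
      have := hx' j
      rw [b.coord_add_smul_sub, b.coord_apply, b.coord_apply]
      split_ifs <;> subst_vars <;> linarith
    · have := hx' i
      change b.coord j _ ≤ b.coord i _
      rw [b.coord_add_smul_sub, b.coord_add_smul_sub]
      simp only [b.coord_apply, hij, hij.symm, if_true, if_false]
      linarith
  · rintro ⟨hy, hyij⟩
    have hy' : ∀ k, 0 ≤ b.coord k y := hy
    have hyij' : b.coord j y ≤ b.coord i y := hyij
    refine ⟨y + (-b.coord j y) • (b i - b j), fun k ↦ ?_, ?_⟩
    · have := hy' k
      have := hy' j
      rw [b.coord_add_smul_sub, b.coord_apply, b.coord_apply]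
      split_ifs <;> subst_vars <;> linarith
    · simp only [b.coord_add_smul_sub, b.coord_apply, hij.symm, if_true, if_false]
      module

variable [FiniteDimensional ℝ E] [MeasurableSpace E] [BorelSpace E]
  (μ : Measure E) [μ.IsAddHaarMeasure]

theorem AffineBasis.setIntegral_convexHull_inter_le [Finite ι] (b : AffineBasis ι ℝ E) {i j : ι}
    (hij : i ≠ j) (f : E → ℝ) :
    ∫ x in convexHull ℝ (Set.range b) ∩ {x | b.coord j x ≤ b.coord i x}, f x ∂μ =
      1 / 2 * ∫ x in convexHull ℝ (Set.range b),
        f (x + (b.coord j x / 2) • (b i - b j)) ∂μ := by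
  classical
  set u : E := (1 / 2 : ℝ) • (b i - b j) with hu
  have hT : (fun x ↦ x + (b.coord j x / 2) • (b i - b j)) = fun x ↦ x + b.coord j x • u := by
    funext x
    rw [hu, smul_smul]
    ring_nf
  set L : E →L[ℝ] E := LinearMap.toContinuousLinearMap
    (LinearMap.transvection (b.coord j).linear u) with hL
  have hlin : (b.coord j).linear u = -1 / 2 := by
    have h := (b.coord j).linearMap_vsub (b i) (b j)
    rw [vsub_eq_sub] at h
    rw [hu, map_smul, h]
    simp [b.coord_apply_ne hij.symm]
    norm_num
  have hdet : L.det = 1 / 2 := by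
    change LinearMap.det (LinearMap.transvection (b.coord j).linear u) = 1 / 2
    rw [LinearMap.transvection.det, hlin]
    norm_num
  have hform : (fun x ↦ x + b.coord j x • u) = fun x ↦ L x + b.coord j 0 • u := by
    funext x
    have h := congrFun (b.coord j).decomp x
    simp only [Pi.add_apply] at h
    rw [h]
    simp [hL, LinearMap.transvection.apply, add_smul, add_assoc]
  have hderiv : ∀ x ∈ convexHull ℝ (Set.range b), HasFDerivWithinAt
      (fun x ↦ x + b.coord j x • u) L (convexHull ℝ (Set.range b)) x := by
    intro x _
    rw [hform]
    exact (L.hasFDerivAt.add_const _).hasFDerivWithinAt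
  have hinj : Function.Injective fun x ↦ x + b.coord j x • u := by
    have hker : Function.Injective L := by
      have hne : L.det ≠ 0 := by
        rw [hdet]
        norm_num
      exact (L.toContinuousLinearEquivOfDetNeZero hne).injective
    rw [hform]
    exact fun x y h ↦ hker (add_right_cancel h)
  have hmeas : MeasurableSet (convexHull ℝ (Set.range b)) :=
    ((Set.finite_range b).isCompact_convexHull ℝ).measurableSet
  rw [← b.image_convexHull_bisection hij, hT,
    integral_image_eq_integral_abs_det_fderiv_smul μ hmeas hderiv hinj.injOn, hdet]
  simp_rw [fun x ↦ congrFun hT x]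
  rw [← integral_const_mul]
  simp

theorem AffineBasis.measure_setOf_coord_eq (b : AffineBasis ι ℝ E) {i j : ι} (hij : i ≠ j) :
    μ {x | b.coord i x = b.coord j x} = 0 := by
  let S : AffineSubspace ℝ E :=
    { carrier := {x | b.coord i x = b.coord j x}
      smul_vsub_vadd_mem' := by
        intro c p q r hp hq hr
        change b.coord i _ = b.coord j _
        rw [AffineMap.map_vadd, AffineMap.map_vadd, map_smul, map_smul, AffineMap.linearMap_vsub,
          AffineMap.linearMap_vsub, hp, hq, hr] }
  refine Measure.addHaar_affineSubspace μ S fun h ↦ ?_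
  have hmem : b i ∈ S := h ▸ AffineSubspace.mem_top ℝ E (b i)
  have hmem' : b.coord i (b i) = b.coord j (b i) := hmem
  rw [b.coord_apply_eq, b.coord_apply_ne hij.symm] at hmem'
  exact one_ne_zero hmem'

theorem AffineBasis.setIntegral_convexHull_bisection [Finite ι] (b : AffineBasis ι ℝ E) {i j : ι}
    (hij : i ≠ j) {f : E → ℝ} (hf : Continuous f) :
    ∫ x in convexHull ℝ (Set.range b), f x ∂μ =
      1 / 2 * ∫ x in convexHull ℝ (Set.range b), f (x + (b.coord j x / 2) • (b i - b j)) ∂μ +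
      1 / 2 * ∫ x in convexHull ℝ (Set.range b),
        f (x + (b.coord i x / 2) • (b j - b i)) ∂μ := by
  have hci := (b.coord i).continuous_of_finiteDimensional
  have hcj := (b.coord j).continuous_of_finiteDimensional
  have hint : IntegrableOn f (convexHull ℝ (Set.range b)) μ :=
    hf.continuousOn.integrableOn_compact ((Set.finite_range b).isCompact_convexHull ℝ)
  rw [← b.setIntegral_convexHull_inter_le μ hij, ← b.setIntegral_convexHull_inter_le μ hij.symm,
    ← integral_inter_add_sdiff (isClosed_le hcj hci).measurableSet hint]
  congr 1
  refine setIntegral_congr_set ?_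
  filter_upwards [measure_eq_zero_iff_ae_notMem.1 (b.measure_setOf_coord_eq μ hij)] with x hx
  refine propext (and_congr_right fun _ ↦ ?_)
  change ¬ b.coord j x ≤ b.coord i x ↔ b.coord i x ≤ b.coord j x
  exact ⟨fun h ↦ (lt_of_not_ge h).le, fun h ↦ not_le_of_gt (lt_of_le_of_ne h hx)⟩

theorem AffineBasis.integrableOn_coord_mul_coord [Finite ι] (b : AffineBasis ι ℝ E) (i j : ι) :
    IntegrableOn (fun x ↦ b.coord i x * b.coord j x) (convexHull ℝ (Set.range b)) μ :=
  ((b.coord i).continuous_of_finiteDimensional.mul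
    (b.coord j).continuous_of_finiteDimensional).continuousOn.integrableOn_compact
    ((Set.finite_range b).isCompact_convexHull ℝ)

theorem AffineBasis.three_mul_setIntegral_coord_sq [Finite ι] (b : AffineBasis ι ℝ E) {i j : ι}
    (hij : i ≠ j) :
    3 * ∫ x in convexHull ℝ (Set.range b), b.coord i x * b.coord i x ∂μ =
      4 * ∫ x in convexHull ℝ (Set.range b), b.coord i x * b.coord j x ∂μ +
        ∫ x in convexHull ℝ (Set.range b), b.coord j x * b.coord j x ∂μ := by
  have hci := (b.coord i).continuous_of_finiteDimensional
  have h := b.setIntegral_convexHull_bisection μ hij (hci.mul hci)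
  have h₁ : ∀ x, (b.coord i x + b.coord j x / 2) * (b.coord i x + b.coord j x / 2) =
      b.coord i x * b.coord i x + b.coord i x * b.coord j x +
        1 / 4 * (b.coord j x * b.coord j x) := fun x ↦ by ring
  have h₂ : ∀ x, (b.coord i x - b.coord i x / 2) * (b.coord i x - b.coord i x / 2) =
      1 / 4 * (b.coord i x * b.coord i x) := fun x ↦ by ring
  simp only [Pi.mul_apply, b.coord_add_smul_sub, b.coord_apply_eq, b.coord_apply_ne hij,
    sub_zero, mul_one, zero_sub, mul_neg, ← sub_eq_add_neg, h₁, h₂] at h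
  have hii := b.integrableOn_coord_mul_coord μ i i
  have hjj := b.integrableOn_coord_mul_coord μ j j
  have hij' := b.integrableOn_coord_mul_coord μ i j
  have hadd : IntegrableOn (fun x ↦ b.coord i x * b.coord i x + b.coord i x * b.coord j x)
      (convexHull ℝ (Set.range b)) μ := hii.add hij'
  rw [integral_add hadd (hjj.const_mul _), integral_add hii hij', integral_const_mul,
    integral_const_mul] at h
  linarith

theorem AffineBasis.setIntegral_coord_sq_eq_two_mul [Finite ι] (b : AffineBasis ι ℝ E) {i j : ι}
    (hij : i ≠ j) :
    ∫ x in convexHull ℝ (Set.range b), b.coord i x * b.coord i x ∂μ =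
      2 * ∫ x in convexHull ℝ (Set.range b), b.coord i x * b.coord j x ∂μ := by
  have h₁ := b.three_mul_setIntegral_coord_sq μ hij
  have h₂ := b.three_mul_setIntegral_coord_sq μ hij.symm
  simp_rw [mul_comm (b.coord j _) (b.coord i _)] at h₂
  linarith

/-- The mixed second moments of the barycentric coordinates over a simplex. -/
theorem AffineBasis.setIntegral_coord_mul_coord [Fintype ι] (b : AffineBasis ι ℝ E) {i j : ι}
    (hij : i ≠ j) :
    ∫ x in convexHull ℝ (Set.range b), b.coord i x * b.coord j x ∂μ =
      μ.real (convexHull ℝ (Set.range b)) / (Fintype.card ι * (Fintype.card ι + 1)) := by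
  classical
  set A := ∫ x in convexHull ℝ (Set.range b), b.coord i x * b.coord j x ∂μ with hA
  have hsq : ∀ k, ∫ x in convexHull ℝ (Set.range b), b.coord k x * b.coord k x ∂μ = 2 * A := by
    intro k
    have hi := b.setIntegral_coord_sq_eq_two_mul μ hij
    rcases eq_or_ne i k with rfl | hk
    · exact hi
    · have h := b.setIntegral_coord_sq_eq_two_mul μ hk
      have h' := b.setIntegral_coord_sq_eq_two_mul μ hk.symm
      simp_rw [mul_comm (b.coord k _) (b.coord i _)] at h'
      linarith
  have hmul : ∀ k l, ∫ x in convexHull ℝ (Set.range b), b.coord k x * b.coord l x ∂μ =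
      A + if k = l then A else 0 := by
    intro k l
    split_ifs with hkl
    · subst hkl
      rw [hsq]
      ring
    · have h := b.setIntegral_coord_sq_eq_two_mul μ hkl
      rw [hsq] at h
      linarith
  have hone : ∫ x in convexHull ℝ (Set.range b), (1 : ℝ) ∂μ =
      ∑ k, ∑ l, ∫ x in convexHull ℝ (Set.range b), b.coord k x * b.coord l x ∂μ := by
    have hpt : ∀ x, (1 : ℝ) = ∑ k, ∑ l, b.coord k x * b.coord l x := fun x ↦ by
      rw [← Finset.sum_mul_sum, b.sum_coord_apply_eq_one, one_mul]
    rw [integral_congr_ae (Eventually.of_forall hpt), integral_finsetSum]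
    · refine Finset.sum_congr rfl fun k _ ↦ integral_finsetSum _ fun l _ ↦ ?_
      exact b.integrableOn_coord_mul_coord μ k l
    · exact fun k _ ↦ integrable_finsetSum _ fun l _ ↦ b.integrableOn_coord_mul_coord μ k l
  simp only [hmul, Finset.sum_add_distrib, Finset.sum_const, Finset.sum_ite_eq,
    Finset.mem_univ, if_true, Finset.card_univ, nsmul_eq_mul, setIntegral_const, smul_eq_mul,
    mul_one] at hone
  have hcard : (0 : ℝ) < Fintype.card ι := by
    exact_mod_cast Fintype.card_pos_iff.2 ⟨i⟩
  rw [eq_div_iff (by positivity), hone]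
  ring

end Moments

theorem sum_sum_eq_two_mul_sum_sum_Ioi {ι : Type*} [Fintype ι] [LinearOrder ι]
    [LocallyFiniteOrder ι] [LocallyFiniteOrderTop ι] [LocallyFiniteOrderBot ι] (f : ι → ι → ℝ)
    (hdiag : ∀ i, f i i = 0) (hsymm : ∀ i j, f i j = f j i) :
    ∑ i, ∑ j, f i j = 2 * ∑ i, ∑ j ∈ Finset.Ioi i, f i j := by
  have h := Finset.sum_sum_Ioi_add_eq_sum_sum_off_diag f
  have h' : ∀ i, ∑ j ∈ {i}ᶜ, f j i = ∑ j, f i j := fun i ↦ by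
    rw [← Finset.sum_compl_add_sum {i}, Finset.sum_singleton, hdiag, add_zero]
    exact Finset.sum_congr rfl fun j _ ↦ hsymm j i
  simp_rw [h', fun i j ↦ hsymm j i, ← two_mul, ← Finset.mul_sum] at h
  exact h.symm

theorem sum_mul_norm_sq_sub_norm_sum_smul_sq {ι E : Type*} [Fintype ι] [NormedAddCommGroup E]
    [InnerProductSpace ℝ E] (w : ι → ℝ) (hw : ∑ i, w i = 1) (p : ι → E) :
    ∑ i, w i * ‖p i‖ ^ 2 - ‖∑ i, w i • p i‖ ^ 2 =
      1 / 2 * ∑ i, ∑ j, w i * w j * dist (p i) (p j) ^ 2 := by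
  have h : ∀ i j, w i * w j * dist (p i) (p j) ^ 2 =
      w j * (w i * ‖p i‖ ^ 2) + w i * (w j * ‖p j‖ ^ 2) -
        2 * (w i * (w j * inner ℝ (p i) (p j))) := fun i j ↦ by
    rw [dist_eq_norm, norm_sub_sq_real]
    ring
  have hnorm : ‖∑ i, w i • p i‖ ^ 2 = ∑ i, ∑ j, w i * (w j * inner ℝ (p i) (p j)) := by
    rw [← real_inner_self_eq_norm_sq]
    simp_rw [sum_inner, inner_sum, real_inner_smul_left, real_inner_smul_right]
  simp_rw [h, Finset.sum_sub_distrib, Finset.sum_add_distrib, ← Finset.mul_sum, ← Finset.sum_mul,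
    hw, one_mul]
  rw [hnorm]
  simp_rw [← Finset.mul_sum]
  ring

theorem AffineBasis.map_eq_sum_coord_mul {ι E : Type*} [Fintype ι] [AddCommGroup E] [Module ℝ E]
    (b : AffineBasis ι ℝ E) (g : E →ᵃ[ℝ] ℝ) (x : E) : g x = ∑ i, b.coord i x * g (b i) := by
  conv_lhs => rw [← b.affineCombination_coord_eq_self x]
  have hw := b.sum_coord_apply_eq_one x
  rw [Finset.univ.map_affineCombination b _ hw,
    Finset.affineCombination_eq_linear_combination _ _ _ hw]
  simp

/-- Rajan's identity: for a `d`-simplex `Δ = conv{v 0, …, v d}` in `ℝ^d` and the affine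
map `g` interpolating `x ↦ ‖x‖²` at the vertices,
`∫_Δ (g x − ‖x‖²) dx = vol(Δ) · (Σ_{i<j} ‖v i − v j‖²) / ((d+1)(d+2))`,
i.e. `F_R(Δ) = (d+1)(d+2) · F_E(Δ)`. -/
theorem rajan_identity (d : ℕ) (v : Fin (d + 1) → EuclideanSpace ℝ (Fin d))
    (hv : AffineIndependent ℝ v)
    (g : EuclideanSpace ℝ (Fin d) →ᵃ[ℝ] ℝ) (hg : ∀ i, g (v i) = ‖v i‖ ^ 2) :
    ∫ x in convexHull ℝ (Set.range v), (g x - ‖x‖ ^ 2) =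
      (MeasureTheory.volume (convexHull ℝ (Set.range v))).toReal *
        (∑ i : Fin (d + 1), ∑ j ∈ Finset.Ioi i, dist (v i) (v j) ^ 2) /
          ((d + 1) * (d + 2) : ℝ) := by
  let b : AffineBasis (Fin (d + 1)) ℝ (EuclideanSpace ℝ (Fin d)) :=
    ⟨v, hv, hv.affineSpan_eq_top_iff_card_eq_finrank_add_one.2 (by simp)⟩
  change ∫ x in convexHull ℝ (Set.range b), (g x - ‖x‖ ^ 2) =
    volume.real (convexHull ℝ (Set.range b)) *
      (∑ i : Fin (d + 1), ∑ j ∈ Finset.Ioi i, dist (b i) (b j) ^ 2) / ((d + 1) * (d + 2) : ℝ)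
  have hpt : ∀ x, g x - ‖x‖ ^ 2 = ∑ i : Fin (d + 1), ∑ j ∈ Finset.Ioi i,
      b.coord i x * b.coord j x * dist (b i) (b j) ^ 2 := fun x ↦ by
    have hgx : g x = ∑ i, b.coord i x * ‖b i‖ ^ 2 := by
      rw [b.map_eq_sum_coord_mul g x]
      exact Finset.sum_congr rfl fun i _ ↦ congrArg _ (hg i)
    have h := sum_mul_norm_sq_sub_norm_sum_smul_sq (fun i ↦ b.coord i x)
      (b.sum_coord_apply_eq_one x) b
    rw [b.linear_combination_coord_eq_self, ← hgx, sum_sum_eq_two_mul_sum_sum_Ioi] at h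
    · rw [h]
      ring
    · simp
    · intro i j
      rw [dist_comm, mul_comm (b.coord i x)]
  have hint : ∀ i j, IntegrableOn (fun x ↦ b.coord i x * b.coord j x * dist (b i) (b j) ^ 2)
      (convexHull ℝ (Set.range b)) volume := fun i j ↦
    (b.integrableOn_coord_mul_coord volume i j).mul_const _
  simp_rw [hpt]
  rw [integral_finsetSum _ fun i _ ↦ integrable_finsetSum _ fun j _ ↦ hint i j, Finset.mul_sum,
    Finset.sum_div]
  refine Finset.sum_congr rfl fun i _ ↦ ?_
  rw [integral_finsetSum _ fun j _ ↦ hint i j, Finset.mul_sum, Finset.sum_div]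
  refine Finset.sum_congr rfl fun j hj ↦ ?_
  rw [integral_mul_const, b.setIntegral_coord_mul_coord volume (Finset.mem_Ioi.1 hj).ne,
    Fintype.card_fin]
  push_cast
  ring
end
end

section
/- Isometry invariance of the lifted-volume functional: Let v₀, …, v_d be affinely independent points in ℝ^d and let φ : ℝ^d → ℝ^d be an isometry. Let g be the unique affine map with g(v_i) = ‖v_i‖² for all i, and let g' be the unique affine map with g'(φ(v_i)) = ‖φ(v_i)‖² for all i. Then ∫_{conv{φ(v₀),…,φ(v_d)}} (g'(x) − ‖x‖²) dx = ∫_{conv{v₀,…,v_d}} (g(x) − ‖x‖²) dx, where both integrals are with respect to d-dimensional Lebesgue measure. In other words, the functional F_E(Δ) = ∫_Δ (g_Δ(x) − ‖x‖²) dx on d-simplices is invariant under isometries of ℝ^d. -/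
open Metric MeasureTheory Filter

noncomputable section

/-- An affine isometry of a Euclidean space onto itself preserves Lebesgue measure. -/
theorem AffineIsometryEquiv.measurePreserving_volume {E : Type*} [NormedAddCommGroup E]
    [InnerProductSpace ℝ E] [FiniteDimensional ℝ E] [MeasurableSpace E] [BorelSpace E]
    (e : E ≃ᵃⁱ[ℝ] E) : MeasurePreserving e := by
  have he : (e : E → E) = (fun x ↦ x + e 0) ∘ e.linearIsometryEquiv := by
    ext x
    simpa using e.map_vadd 0 x
  rw [he]
  exact (measurePreserving_add_right volume (e 0)).comp e.linearIsometryEquiv.measurePreserving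

/-- If the affine maps `g` and `g'` interpolate the squared norm on `s` and on its image under an
affine isometry `e`, then their gaps to the squared norm correspond under `e` on the convex hull
of `s`. -/
theorem AffineIsometryEquiv.interpolation_gap_eq {E : Type*} [NormedAddCommGroup E]
    [InnerProductSpace ℝ E] (e : E ≃ᵃⁱ[ℝ] E) {s : Set E} {g g' : E →ᵃ[ℝ] ℝ}
    (hg : ∀ x ∈ s, g x = ‖x‖ ^ 2) (hg' : ∀ x ∈ s, g' (e x) = ‖e x‖ ^ 2) {x : E}
    (hx : x ∈ convexHull ℝ s) : g' (e x) - ‖e x‖ ^ 2 = g x - ‖x‖ ^ 2 := by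
  have norm_sq (y : E) : ‖e y‖ ^ 2 =
      ‖y‖ ^ 2 + 2 * inner ℝ (e 0) (e.linearIsometryEquiv y) + ‖e 0‖ ^ 2 := by
    have hy : e y = e.linearIsometryEquiv y + e 0 := by simpa using e.map_vadd 0 y
    rw [hy, norm_add_sq_real, LinearIsometryEquiv.norm_map, real_inner_comm]
  let q : E →ᵃ[ℝ] ℝ :=
    ((2 : ℝ) • (innerₗ E (e 0) ∘ₗ e.linearIsometryEquiv.toLinearEquiv.toLinearMap)).toAffineMap
      + AffineMap.const ℝ E (‖e 0‖ ^ 2)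
  let h : E →ᵃ[ℝ] ℝ := g'.comp e.toAffineEquiv.toAffineMap - g - q
  have h_apply (y : E) : h y = g' (e y) - ‖e y‖ ^ 2 - (g y - ‖y‖ ^ 2) := by
    have : h y = g' (e y) - g y -
        (2 * inner ℝ (e 0) (e.linearIsometryEquiv y) + ‖e 0‖ ^ 2) := rfl
    rw [this, norm_sq y]
    ring
  have hsub : convexHull ℝ s ⊆ h ⁻¹' {0} := by
    refine convexHull_min (fun y hy ↦ ?_) ((convex_singleton 0).affine_preimage h)
    simp [h_apply, hg y hy, hg' y hy]
  have := hsub hx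
  rw [Set.mem_preimage, Set.mem_singleton_iff, h_apply] at this
  linarith

/-- Isometry invariance of the lifted-volume functional: for a `d`-simplex with vertices
`v 0, …, v d` in `ℝ^d`, an isometry `φ` of `ℝ^d`, and the affine maps `g`, `g'`
interpolating `x ↦ ‖x‖²` at the vertices of the simplex and of its image,
the volume between the lifted simplex and the paraboloid is unchanged:
`∫_{conv(φ∘v)} (g' x − ‖x‖²) dx = ∫_{conv(v)} (g x − ‖x‖²) dx`. -/
theorem lifted_volume_isometry_invariant (d : ℕ)
    (v : Fin (d + 1) → EuclideanSpace ℝ (Fin d)) (hv : AffineIndependent ℝ v)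
    (φ : EuclideanSpace ℝ (Fin d) → EuclideanSpace ℝ (Fin d)) (hφ : Isometry φ)
    (g g' : EuclideanSpace ℝ (Fin d) →ᵃ[ℝ] ℝ)
    (hg : ∀ i, g (v i) = ‖v i‖ ^ 2) (hg' : ∀ i, g' (φ (v i)) = ‖φ (v i)‖ ^ 2) :
    ∫ x in convexHull ℝ (Set.range (φ ∘ v)), (g' x - ‖x‖ ^ 2) =
      ∫ x in convexHull ℝ (Set.range v), (g x - ‖x‖ ^ 2) := by
  obtain ⟨e, rfl⟩ : ∃ e : EuclideanSpace ℝ (Fin d) ≃ᵃⁱ[ℝ] EuclideanSpace ℝ (Fin d), ⇑e = φ :=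
    ⟨hφ.affineIsometryOfStrictConvexSpace.toAffineIsometryEquiv rfl, rfl⟩
  have himage : convexHull ℝ (Set.range (e ∘ v)) = e '' convexHull ℝ (Set.range v) := by
    rw [Set.range_comp]
    exact (e.toAffineEquiv.toAffineMap.image_convexHull _).symm
  rw [himage, e.measurePreserving_volume.setIntegral_image_emb
    e.toHomeomorph.measurableEmbedding]
  refine setIntegral_congr_fun ((Set.finite_range v).isCompact_convexHull (𝕜 := ℝ)).measurableSet ?_
  exact fun x hx ↦ e.interpolation_gap_eq (Set.forall_mem_range.2 hg) (Set.forall_mem_range.2 hg') hx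
end
end
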